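/- Let Γ be an infinite-horizon discounted zero-sum polymatrix switching-control Markov game and ε ≥ 0. If (π*, w*) is a feasible point of P_NE' whose objective value is at most ε (an ε-approximate global minimum, since the global minimum equals 0), then π* is an nε-approximate NE of Γ (indeed even an ε-approximate NE). Conversely, if π* is an ε-approximate NE of Γ and w* is the vector of best-response values w*_k(s) = V^{†,π*_{−k}}_k(s) for all k, s, then (π*, w*) is feasible for P_NE' and attains an nε-approximate global minimum. -/

import Mathlib

open Finset

section InfiniteHorizon

variable {n : ℕ} {S : Type*} [Fintype S] [DecidableEq S] {A : Fin n → Type*}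
  [∀ k, Fintype (A k)] [∀ k, DecidableEq (A k)]

/-- `f` is a probability distribution on the finite type `α`. -/
def IsDist {α : Type*} [Fintype α] (f : α → ℝ) : Prop :=
  (∀ x, 0 ≤ f x) ∧ ∑ x, f x = 1

/-- A stationary Markov policy: a distribution on `α` for every state. -/
def IsStatPol {S : Type*} {α : Type*} [Fintype α] (π : S → α → ℝ) : Prop :=
  ∀ s : S, IsDist (π s)

/-- A valid (stationary) transition kernel. -/
def IsKer (P : S → (∀ k, A k) → S → ℝ) : Prop :=
  ∀ s a, IsDist (P s a)

/-- Rewards take values in `[-1, 1]`. -/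
def IsRew (r : Fin n → S → (∀ k, A k) → ℝ) : Prop :=
  ∀ k s a, r k s a ∈ Set.Icc (-1 : ℝ) 1

/-- `h`-step state-to-state transition matrix under the joint policy `σ`. -/
noncomputable def matPow (P : S → (∀ k, A k) → S → ℝ)
    (σ : S → (∀ k, A k) → ℝ) : ℕ → S → S → ℝ
  | 0 => fun s s' => if s = s' then 1 else 0
  | h + 1 => fun s s' => ∑ t, matPow P σ h s t * ∑ a, σ t a * P t a s'

/-- Expected one-step reward under `σ`. -/
noncomputable def expRew (σ : S → (∀ k, A k) → ℝ)
    (rk : S → (∀ k, A k) → ℝ) (s : S) : ℝ :=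
  ∑ a, σ s a * rk s a

/-- `vinf γ P rk σ s` is the expected `γ`-discounted infinite-horizon reward
`V^σ(s) = E[∑ₕ γ^(h-1) r(s_h, a_h)]`, started at state `s`. -/
noncomputable def vinf (γ : ℝ) (P : S → (∀ k, A k) → S → ℝ)
    (rk : S → (∀ k, A k) → ℝ) (σ : S → (∀ k, A k) → ℝ) (s : S) : ℝ :=
  ∑' h : ℕ, γ ^ h * ∑ s', matPow P σ h s s' * expRew σ rk s'

/-- Value under the initial distribution `ρ`. -/
noncomputable def vinfρ (γ : ℝ) (P : S → (∀ k, A k) → S → ℝ)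
    (rk : S → (∀ k, A k) → ℝ) (σ : S → (∀ k, A k) → ℝ) (ρ : S → ℝ) : ℝ :=
  ∑ s, ρ s * vinf γ P rk σ s

/-- The joint stationary policy in which player `k` plays `π'` independently
against the marginal `σ₋ₖ` of the joint policy `σ`. -/
noncomputable def deviateI (k : Fin n) (π' : S → A k → ℝ)
    (σ : S → (∀ j, A j) → ℝ) : S → (∀ j, A j) → ℝ :=
  fun s a => π' s (a k) * ∑ b : A k, σ s (Function.update a k b)

/-- The marginal stationary policy of player `k` induced by `σ`. -/
noncomputable def marginalI (σ : S → (∀ j, A j) → ℝ) (k : Fin n) :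
    S → A k → ℝ :=
  fun s b => ∑ a : ∀ j, A j, if a k = b then σ s a else 0

/-- The product policy induced by individual stationary policies `π k`. -/
def prodPolI (π : ∀ k, S → A k → ℝ) : S → (∀ j, A j) → ℝ :=
  fun s a => ∏ k, π k s (a k)

/-- `σ` is an `ε`-approximate CCE of the discounted game (w.r.t. `ρ`). -/
def IsCCEI (γ : ℝ) (P : S → (∀ k, A k) → S → ℝ)
    (r : Fin n → S → (∀ k, A k) → ℝ) (ρ : S → ℝ) (ε : ℝ)
    (σ : S → (∀ k, A k) → ℝ) : Prop :=
  ∀ k : Fin n, ∀ π' : S → A k → ℝ, IsStatPol π' →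
    vinfρ γ P (r k) (deviateI k π' σ) ρ - vinfρ γ P (r k) σ ρ ≤ ε

/-- The stationary product policy `π` is an `ε`-approximate NE (w.r.t. `ρ`). -/
def IsNEI (γ : ℝ) (P : S → (∀ k, A k) → S → ℝ)
    (r : Fin n → S → (∀ k, A k) → ℝ) (ρ : S → ℝ) (ε : ℝ)
    (π : ∀ k, S → A k → ℝ) : Prop :=
  ∀ k : Fin n, ∀ π' : S → A k → ℝ, IsStatPol π' →
    vinfρ γ P (r k) (deviateI k π' (prodPolI π)) ρ -
      vinfρ γ P (r k) (prodPolI π) ρ ≤ ε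

/-- `v` is the best-response value `V^{†,σ₋ₖ}_k(s)` of player `k` against `σ`. -/
def IsBRValI (γ : ℝ) (P : S → (∀ k, A k) → S → ℝ)
    (rk : S → (∀ k, A k) → ℝ) (σ : S → (∀ k, A k) → ℝ)
    (k : Fin n) (s : S) (v : ℝ) : Prop :=
  IsGreatest {x : ℝ | ∃ π' : S → A k → ℝ, IsStatPol π' ∧
    x = vinf γ P rk (deviateI k π' σ) s} v

/-- The game is zero-sum polymatrix. -/
def IsZSPolymatrixI (r : Fin n → S → (∀ k, A k) → ℝ) : Prop :=
  (∀ s a, ∑ k, r k s a = 0) ∧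
  ∃ q : (k : Fin n) → (j : Fin n) → S → A k → A j → ℝ,
    (∀ k j s x y, q k j s x y ∈ Set.Icc (-1 : ℝ) 1) ∧
    ∀ k s a, r k s a = ∑ j ∈ univ.filter (fun j => j ≠ k), q k j s (a k) (a j)

/-- Switching control: at every state a single player controls the transition. -/
def SwitchingControlI (P : S → (∀ k, A k) → S → ℝ) : Prop :=
  ∀ s : S, ∃ k : Fin n, ∀ a a' : ∀ j, A j, a k = a' k → P s a = P s a'

/-- Feasibility for the nonlinear program `P_NE'`. -/
def FeasNEI (γ : ℝ) (P : S → (∀ k, A k) → S → ℝ)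
    (r : Fin n → S → (∀ k, A k) → ℝ)
    (π : ∀ k, S → A k → ℝ) (w : Fin n → S → ℝ) : Prop :=
  (∀ k, IsStatPol (π k)) ∧
  ∀ k : Fin n, ∀ s, ∀ b : A k,
    (∑ a : ∀ j, A j, if a k = b then
        (∏ j ∈ univ.filter (fun j => j ≠ k), π j s (a j)) *
          (r k s a + γ * ∑ s', P s a s' * w k s')
      else 0) ≤ w k s

/-- Objective of the nonlinear program `P_NE'`. -/
noncomputable def objNEI (γ : ℝ) (P : S → (∀ k, A k) → S → ℝ)
    (r : Fin n → S → (∀ k, A k) → ℝ) (ρ : S → ℝ)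
    (π : ∀ k, S → A k → ℝ) (w : Fin n → S → ℝ) : ℝ :=
  ∑ k, ∑ s, ρ s * (w k s - vinf γ P (r k) (prodPolI π) s)

/-- Feasibility for the best-response linear program `P_BR'(σ̂)`. -/
def FeasBRI (γ : ℝ) (P : S → (∀ k, A k) → S → ℝ)
    (r : Fin n → S → (∀ k, A k) → ℝ)
    (σ' : S → (∀ k, A k) → ℝ) (w : Fin n → S → ℝ) : Prop :=
  ∀ k : Fin n, ∀ s, ∀ b : A k,
    (∑ a : ∀ j, A j, if a k = b then
        (∑ b' : A k, σ' s (Function.update a k b')) *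
          (r k s a + γ * ∑ s', P s a s' * w k s')
      else 0) ≤ w k s

/-- Objective of the best-response linear program `P_BR'(σ̂)`. -/
noncomputable def objBRI (γ : ℝ) (P : S → (∀ k, A k) → S → ℝ)
    (r : Fin n → S → (∀ k, A k) → ℝ) (ρ : S → ℝ)
    (σ' : S → (∀ k, A k) → ℝ) (w : Fin n → S → ℝ) : ℝ :=
  ∑ k, ∑ s, ρ s * (w k s - vinf γ P (r k) σ' s)

end InfiniteHorizon
section PolicyEvaluation

set_option linter.unusedSectionVars false

variable {n : ℕ} {S : Type*} [Fintype S] [DecidableEq S] {A : Fin n → Type*}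
  [∀ k, Fintype (A k)] [∀ k, DecidableEq (A k)]

/-- State-to-state transition kernel induced by the joint policy `σ`. -/
noncomputable def stepKer (P : S → (∀ k, A k) → S → ℝ)
    (σ : S → (∀ k, A k) → ℝ) (s s' : S) : ℝ :=
  ∑ a, σ s a * P s a s'

lemma IsDist.sum_mul_le {α : Type*} [Fintype α] {p f : α → ℝ} (hp : IsDist p) {c : ℝ}
    (hf : ∀ x, f x ≤ c) : ∑ x, p x * f x ≤ c := by
  calc ∑ x, p x * f x ≤ ∑ x, p x * c :=
        Finset.sum_le_sum fun x _ => mul_le_mul_of_nonneg_left (hf x) (hp.1 x)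
    _ = c := by rw [← Finset.sum_mul, hp.2, one_mul]

lemma IsDist.abs_sum_mul_le {α : Type*} [Fintype α] {p f : α → ℝ} (hp : IsDist p) {c : ℝ}
    (hf : ∀ x, |f x| ≤ c) : |∑ x, p x * f x| ≤ c := by
  refine abs_le.2 ⟨?_, hp.sum_mul_le fun x => (abs_le.1 (hf x)).2⟩
  have h := hp.sum_mul_le (f := fun x => - f x) (c := c) fun x => by
    linarith [(abs_le.1 (hf x)).1]
  simp only [mul_neg, Finset.sum_neg_distrib] at h
  linarith

lemma IsDist.bind {α β : Type*} [Fintype α] [Fintype β] {p : α → ℝ} {q : α → β → ℝ}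
    (hp : IsDist p) (hq : ∀ x, IsDist (q x)) : IsDist fun y => ∑ x, p x * q x y := by
  refine ⟨fun y => Finset.sum_nonneg fun x _ => mul_nonneg (hp.1 x) ((hq x).1 y), ?_⟩
  rw [Finset.sum_comm]
  simp_rw [← Finset.mul_sum, (hq _).2, mul_one, hp.2]

lemma isDist_stepKer {P : S → (∀ k, A k) → S → ℝ} {σ : S → (∀ k, A k) → ℝ}
    (hP : IsKer P) (hσ : IsStatPol σ) (s : S) : IsDist (stepKer P σ s) :=
  (hσ s).bind (hP s)

lemma isDist_matPow {P : S → (∀ k, A k) → S → ℝ} {σ : S → (∀ k, A k) → ℝ}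
    (hP : IsKer P) (hσ : IsStatPol σ) (h : ℕ) (s : S) : IsDist (matPow P σ h s) := by
  induction h with
  | zero => exact ⟨fun s' => by simp only [matPow]; split_ifs <;> norm_num, by simp [matPow]⟩
  | succ h ih => exact ih.bind (isDist_stepKer hP hσ)

lemma sum_matPow_succ_mul (P : S → (∀ k, A k) → S → ℝ) (σ : S → (∀ k, A k) → ℝ)
    (h : ℕ) (s : S) (v : S → ℝ) :
    ∑ s', matPow P σ (h + 1) s s' * v s' =
      ∑ t, matPow P σ h s t * ∑ s', stepKer P σ t s' * v s' := by
  change ∑ s', (∑ t, matPow P σ h s t * stepKer P σ t s') * v s' = _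
  simp_rw [Finset.sum_mul, Finset.mul_sum, mul_assoc]
  exact Finset.sum_comm

lemma exists_abs_le (v : S → ℝ) : ∃ C, ∀ s, |v s| ≤ C :=
  ⟨∑ s, |v s|, fun s => Finset.single_le_sum (f := fun s => |v s|)
    (fun _ _ => abs_nonneg _) (Finset.mem_univ s)⟩

lemma summable_vinf {γ : ℝ} (hγ : γ ∈ Set.Ioo (0 : ℝ) 1) {P : S → (∀ k, A k) → S → ℝ}
    (hP : IsKer P) {σ : S → (∀ k, A k) → ℝ} (hσ : IsStatPol σ) (v : S → ℝ) (s : S) :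
    Summable fun h : ℕ => γ ^ h * ∑ s', matPow P σ h s s' * v s' := by
  obtain ⟨C, hC⟩ := exists_abs_le v
  refine Summable.of_norm_bounded ((summable_geometric_of_lt_one hγ.1.le hγ.2).mul_right C)
    fun h => ?_
  rw [Real.norm_eq_abs, abs_mul, abs_of_nonneg (pow_nonneg hγ.1.le h)]
  exact mul_le_mul_of_nonneg_left ((isDist_matPow hP hσ h s).abs_sum_mul_le hC)
    (pow_nonneg hγ.1.le h)

/-- A supersolution of the policy evaluation equation dominates the policy's value. -/
lemma vinf_le_of_supersolution {γ : ℝ} (hγ : γ ∈ Set.Ioo (0 : ℝ) 1)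
    {P : S → (∀ k, A k) → S → ℝ} (hP : IsKer P) {σ : S → (∀ k, A k) → ℝ}
    (hσ : IsStatPol σ) (rk : S → (∀ k, A k) → ℝ) (w : S → ℝ)
    (hw : ∀ s, expRew σ rk s + γ * ∑ s', stepKer P σ s s' * w s' ≤ w s) (s : S) :
    vinf γ P rk σ s ≤ w s := by
  have key : ∀ H : ℕ, ∑ h ∈ Finset.range H, γ ^ h * ∑ s', matPow P σ h s s' * expRew σ rk s' ≤
      w s - γ ^ H * ∑ s', matPow P σ H s s' * w s' := by
    intro H
    induction H with
    | zero => simp [matPow]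
    | succ H ih =>
      rw [Finset.sum_range_succ, sum_matPow_succ_mul]
      have h1 : ∑ s', matPow P σ H s s' * expRew σ rk s' ≤
          ∑ s', matPow P σ H s s' * (w s' - γ * ∑ t, stepKer P σ s' t * w t) :=
        Finset.sum_le_sum fun t _ =>
          mul_le_mul_of_nonneg_left (by linarith [hw t]) ((isDist_matPow hP hσ H s).1 t)
      have h2 : ∑ s', matPow P σ H s s' * (w s' - γ * ∑ t, stepKer P σ s' t * w t) =
          ∑ s', matPow P σ H s s' * w s' -
            γ * ∑ s', matPow P σ H s s' * ∑ t, stepKer P σ s' t * w t := by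
        rw [Finset.mul_sum, ← Finset.sum_sub_distrib]
        exact Finset.sum_congr rfl fun _ _ => by ring
      have h3 := mul_le_mul_of_nonneg_left (h1.trans_eq h2) (pow_nonneg hγ.1.le H)
      rw [pow_succ]
      linarith
  have hlim := (summable_vinf hγ hP hσ w s).tendsto_atTop_zero.const_sub (w s)
  rw [sub_zero] at hlim
  exact le_of_tendsto_of_tendsto' (summable_vinf hγ hP hσ (expRew σ rk) s).tendsto_sum_tsum_nat
    hlim key

/-- A solution of the policy evaluation equation is the policy's value. -/
lemma vinf_eq_of_solution {γ : ℝ} (hγ : γ ∈ Set.Ioo (0 : ℝ) 1)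
    {P : S → (∀ k, A k) → S → ℝ} (hP : IsKer P) {σ : S → (∀ k, A k) → ℝ}
    (hσ : IsStatPol σ) (rk : S → (∀ k, A k) → ℝ) (w : S → ℝ)
    (hw : ∀ s, expRew σ rk s + γ * ∑ s', stepKer P σ s s' * w s' = w s) (s : S) :
    vinf γ P rk σ s = w s := by
  refine le_antisymm (vinf_le_of_supersolution hγ hP hσ rk w (fun s => (hw s).le) s) ?_
  have h := vinf_le_of_supersolution hγ hP hσ (fun s a => - rk s a) (fun s => - w s)
    (fun s => by
      have h := hw s
      simp only [expRew, mul_neg, Finset.sum_neg_distrib] at h ⊢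
      linarith) s
  have hneg : vinf γ P (fun s a => - rk s a) σ s = - vinf γ P rk σ s := by
    simp only [vinf, expRew, mul_neg, Finset.sum_neg_distrib, tsum_neg]
  linarith

/-- Expectation of `f` when player `k` plays `b` and every other player `j` plays `p j`. -/
noncomputable def oppExp (p : ∀ j, A j → ℝ) (k : Fin n) (f : (∀ j, A j) → ℝ) (b : A k) : ℝ :=
  ∑ a : ∀ j, A j, if a k = b then
    (∏ j ∈ univ.filter (fun j => j ≠ k), p j (a j)) * f a else 0

lemma prod_update_apply (p : ∀ j, A j → ℝ) (k : Fin n) (x : A k → ℝ) (a : ∀ j, A j) :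
    ∏ j, Function.update p k x j (a j) =
      x (a k) * ∏ j ∈ univ.filter (fun j => j ≠ k), p j (a j) := by
  rw [Finset.filter_ne', ← Finset.mul_prod_erase univ _ (Finset.mem_univ k),
    Function.update_self]
  congr 1
  refine Finset.prod_congr rfl fun j hj => ?_
  rw [Function.update_of_ne (Finset.ne_of_mem_erase hj)]

lemma sum_mul_oppExp (p : ∀ j, A j → ℝ) (k : Fin n) (f : (∀ j, A j) → ℝ) (x : A k → ℝ) :
    ∑ b, x b * oppExp p k f b = ∑ a, (∏ j, Function.update p k x j (a j)) * f a := by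
  simp_rw [oppExp, Finset.mul_sum, mul_ite, mul_zero]
  rw [Finset.sum_comm]
  simp [prod_update_apply, mul_assoc]

lemma isDist_prod {p : ∀ j, A j → ℝ} (hp : ∀ j, IsDist (p j)) :
    IsDist fun a : ∀ j, A j => ∏ j, p j (a j) := by
  refine ⟨fun a => Finset.prod_nonneg fun j _ => (hp j).1 (a j), ?_⟩
  rw [← Fintype.prod_sum]
  simp [(hp _).2]

lemma isDist_update {p : ∀ j, A j → ℝ} (hp : ∀ j, IsDist (p j)) (k : Fin n) {x : A k → ℝ}
    (hx : IsDist x) (j : Fin n) : IsDist (Function.update p k x j) := by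
  rcases eq_or_ne j k with rfl | h
  · rwa [Function.update_self]
  · rw [Function.update_of_ne h]; exact hp j

lemma isDist_single {α : Type*} [Fintype α] [DecidableEq α] (b : α) :
    IsDist (Pi.single b (1 : ℝ)) :=
  ⟨fun x => by rw [Pi.single_apply]; split_ifs <;> norm_num, by simp⟩

lemma oppExp_eq_sum (p : ∀ j, A j → ℝ) (k : Fin n) (f : (∀ j, A j) → ℝ) (b : A k) :
    oppExp p k f b = ∑ a, (∏ j, Function.update p k (Pi.single b 1) j (a j)) * f a := by
  rw [← sum_mul_oppExp]
  simp [Pi.single_apply]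

lemma oppExp_le_add {p : ∀ j, A j → ℝ} (hp : ∀ j, IsDist (p j)) (k : Fin n)
    {f g : (∀ j, A j) → ℝ} {c : ℝ} (h : ∀ a, f a ≤ g a + c) (b : A k) :
    oppExp p k f b ≤ oppExp p k g b + c := by
  have := (isDist_prod (isDist_update hp k (isDist_single b))).sum_mul_le
    (f := fun a => f a - g a) (c := c) fun a => by linarith [h a]
  simp only [mul_sub, Finset.sum_sub_distrib] at this
  rw [oppExp_eq_sum, oppExp_eq_sum]
  linarith

/-- Value for player `k` of playing `b` at `s` against `π`, with continuation values `v`. -/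
noncomputable def actionVal (γ : ℝ) (P : S → (∀ k, A k) → S → ℝ)
    (rk : S → (∀ k, A k) → ℝ) (π : ∀ k, S → A k → ℝ) (k : Fin n) (v : S → ℝ)
    (s : S) (b : A k) : ℝ :=
  oppExp (fun j => π j s) k (fun a => rk s a + γ * ∑ s', P s a s' * v s') b

lemma actionVal_le_add {γ : ℝ} (hγ : 0 ≤ γ) {P : S → (∀ k, A k) → S → ℝ} (hP : IsKer P)
    (rk : S → (∀ k, A k) → ℝ) {π : ∀ k, S → A k → ℝ} (hπ : ∀ k, IsStatPol (π k)) (k : Fin n)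
    {u v : S → ℝ} {d : ℝ} (h : ∀ s, u s ≤ v s + d) (s : S) (b : A k) :
    actionVal γ P rk π k u s b ≤ actionVal γ P rk π k v s b + γ * d := by
  refine oppExp_le_add (fun j => hπ j s) k (fun a => ?_) b
  have h1 := (hP s a).sum_mul_le (f := fun t => u t - v t) (c := d) fun t => by linarith [h t]
  simp only [mul_sub, Finset.sum_sub_distrib] at h1
  have h2 := mul_le_mul_of_nonneg_left h1 hγ
  linarith

/-- The Bellman optimality equation of player `k` against `π` has a solution, attained by a
deterministic stationary policy. -/
lemma exists_bellman_solution {γ : ℝ} (hγ : γ ∈ Set.Ioo (0 : ℝ) 1)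
    {P : S → (∀ k, A k) → S → ℝ} (hP : IsKer P) (rk : S → (∀ k, A k) → ℝ)
    {π : ∀ k, S → A k → ℝ} (hπ : ∀ k, IsStatPol (π k)) (k : Fin n) [Nonempty (A k)] :
    ∃ v : S → ℝ, (∀ s b, actionVal γ P rk π k v s b ≤ v s) ∧
      ∃ g : S → A k, ∀ s, actionVal γ P rk π k v s (g s) = v s := by
  let T : (S → ℝ) → S → ℝ := fun v s =>
    univ.sup' univ_nonempty (actionVal γ P rk π k v s)
  have hT : ∀ u v s, T u s ≤ T v s + γ * dist u v := fun u v s =>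
    Finset.sup'_le _ _ fun b hb =>
      (actionVal_le_add hγ.1.le hP rk hπ k (v := v) (d := dist u v) (fun t => by
        have := (le_abs_self _).trans (dist_le_pi_dist u v t)
        linarith) s b).trans
        (add_le_add_left (Finset.le_sup' (actionVal γ P rk π k v s) hb) _)
  have hc : ContractingWith ⟨γ, hγ.1.le⟩ T := by
    refine ⟨hγ.2, LipschitzWith.of_dist_le_mul fun u v => ?_⟩
    refine (dist_pi_le_iff (mul_nonneg hγ.1.le dist_nonneg)).2 fun s => ?_
    have h1 := hT u v s
    have h2 := hT v u s
    rw [dist_comm] at h2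
    exact abs_le.2 ⟨by linarith, by linarith⟩
  have hfix : ∀ s, T (hc.fixedPoint T) s = hc.fixedPoint T s :=
    congrFun hc.fixedPoint_isFixedPt
  refine ⟨hc.fixedPoint T, fun s b => ?_, ?_⟩
  · exact (Finset.le_sup' (actionVal γ P rk π k _ s) (mem_univ b)).trans_eq (hfix s)
  · choose g _ hg using fun s => Finset.exists_mem_eq_sup' univ_nonempty
      (actionVal γ P rk π k (hc.fixedPoint T) s)
    exact ⟨g, fun s => (hg s).symm.trans (hfix s)⟩

lemma prodPolI_update (π : ∀ k, S → A k → ℝ) (k : Fin n) (π' : S → A k → ℝ) (s : S)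
    (a : ∀ j, A j) :
    prodPolI (Function.update π k π') s a =
      ∏ j, Function.update (fun j => π j s) k (π' s) j (a j) := by
  refine Finset.prod_congr rfl fun j _ => ?_
  rcases eq_or_ne j k with rfl | h
  · simp
  · simp [h]

lemma deviateI_prodPolI {π : ∀ k, S → A k → ℝ} {k : Fin n} (hπ : IsStatPol (π k))
    (π' : S → A k → ℝ) :
    deviateI k π' (prodPolI π) = prodPolI (Function.update π k π') := by
  funext s a
  have h : ∀ b : A k, prodPolI π s (Function.update a k b) =
      π k s b * ∏ j ∈ univ.filter (fun j => j ≠ k), π j s (a j) := fun b => by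
    rw [prodPolI, Finset.filter_ne', ← Finset.mul_prod_erase univ _ (Finset.mem_univ k),
      Function.update_self]
    congr 1
    refine Finset.prod_congr rfl fun j hj => ?_
    rw [Function.update_of_ne (Finset.ne_of_mem_erase hj)]
  rw [prodPolI_update, prod_update_apply, deviateI]
  simp_rw [h, ← Finset.sum_mul, (hπ s).2, one_mul]

lemma isStatPol_deviateI {π : ∀ k, S → A k → ℝ} (hπ : ∀ k, IsStatPol (π k)) {k : Fin n}
    {π' : S → A k → ℝ} (hπ' : IsStatPol π') :
    IsStatPol (deviateI k π' (prodPolI π)) := fun s => by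
  rw [deviateI_prodPolI (hπ k)]
  simpa only [funext (prodPolI_update π k π' s)] using
    isDist_prod (isDist_update (fun j => hπ j s) k (hπ' s))

lemma expRew_deviateI_add {π : ∀ k, S → A k → ℝ} (hπ : ∀ k, IsStatPol (π k)) (γ : ℝ)
    (P : S → (∀ k, A k) → S → ℝ) (rk : S → (∀ k, A k) → ℝ) (k : Fin n)
    (π' : S → A k → ℝ) (v : S → ℝ) (s : S) :
    expRew (deviateI k π' (prodPolI π)) rk s +
        γ * ∑ s', stepKer P (deviateI k π' (prodPolI π)) s s' * v s' =
      ∑ b, π' s b * actionVal γ P rk π k v s b := by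
  rw [deviateI_prodPolI (hπ k)]
  simp_rw [actionVal, sum_mul_oppExp, ← prodPolI_update, mul_add, Finset.sum_add_distrib,
    stepKer, Finset.sum_mul, expRew]
  rw [Finset.sum_comm]
  simp_rw [Finset.mul_sum]
  congr 1
  exact Finset.sum_congr rfl fun _ _ => Finset.sum_congr rfl fun _ _ => by ring

lemma vinf_deviateI_le {γ : ℝ} (hγ : γ ∈ Set.Ioo (0 : ℝ) 1)
    {P : S → (∀ k, A k) → S → ℝ} (hP : IsKer P) (rk : S → (∀ k, A k) → ℝ)
    {π : ∀ k, S → A k → ℝ} (hπ : ∀ k, IsStatPol (π k)) {k : Fin n} {v : S → ℝ}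
    (hv : ∀ s b, actionVal γ P rk π k v s b ≤ v s)
    {π' : S → A k → ℝ} (hπ' : IsStatPol π') (s : S) :
    vinf γ P rk (deviateI k π' (prodPolI π)) s ≤ v s := by
  refine vinf_le_of_supersolution hγ hP (isStatPol_deviateI hπ hπ') rk v (fun s => ?_) s
  rw [expRew_deviateI_add hπ]
  exact (hπ' s).sum_mul_le (hv s)

lemma deviateI_self {π : ∀ k, S → A k → ℝ} {k : Fin n} (hπ : IsStatPol (π k)) :
    deviateI k (π k) (prodPolI π) = prodPolI π := by
  rw [deviateI_prodPolI hπ, Function.update_eq_self]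

/-- The best-response values solve the Bellman inequalities and are attained simultaneously at
all states by one stationary policy. -/
lemma bellman_of_isBRValI {γ : ℝ} (hγ : γ ∈ Set.Ioo (0 : ℝ) 1)
    {P : S → (∀ k, A k) → S → ℝ} (hP : IsKer P) (rk : S → (∀ k, A k) → ℝ)
    {π : ∀ k, S → A k → ℝ} (hπ : ∀ k, IsStatPol (π k)) {k : Fin n} [Nonempty (A k)]
    {w : S → ℝ} (hw : ∀ s, IsBRValI γ P rk (prodPolI π) k s (w s)) :
    (∀ s b, actionVal γ P rk π k w s b ≤ w s) ∧
      ∃ π' : S → A k → ℝ, IsStatPol π' ∧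
        ∀ s, vinf γ P rk (deviateI k π' (prodPolI π)) s = w s := by
  obtain ⟨v, hv, g, hg⟩ := exists_bellman_solution hγ hP rk hπ k
  have hπ' : IsStatPol fun s => Pi.single (g s) (1 : ℝ) := fun s => isDist_single (g s)
  have hval := vinf_eq_of_solution hγ hP (isStatPol_deviateI hπ hπ') rk v fun s => by
    rw [expRew_deviateI_add hπ, ← hg s]
    simp [Pi.single_apply]
  obtain rfl : v = w := funext fun s => by
    refine le_antisymm ((hw s).2 ⟨_, hπ', (hval s).symm⟩) ?_
    obtain ⟨π'', hπ'', h⟩ := (hw s).1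
    exact h ▸ vinf_deviateI_le hγ hP rk hπ hv hπ'' s
  exact ⟨hv, _, hπ', hval⟩

end PolicyEvaluation

theorem PNE_optimum_iff_NE_discounted
    {n : ℕ} {S : Type*} [Fintype S] [DecidableEq S] {A : Fin n → Type*}
    [∀ k, Fintype (A k)] [∀ k, DecidableEq (A k)]
    (γ : ℝ) (P : S → (∀ k, A k) → S → ℝ)
    (r : Fin n → S → (∀ k, A k) → ℝ) (ρ : S → ℝ) (ε : ℝ)
    (hγ : γ ∈ Set.Ioo (0 : ℝ) 1) (hP : IsKer P) (hr : IsRew r)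
    (hρ : IsDist ρ) (hzs : IsZSPolymatrixI r) (hsc : SwitchingControlI P)
    (hε : 0 ≤ ε) :
    (∀ π w, FeasNEI γ P r π w → objNEI γ P r ρ π w ≤ ε →
      IsNEI γ P r ρ ε π ∧ IsNEI γ P r ρ ((n : ℝ) * ε) π) ∧
    (∀ π w, (∀ k, IsStatPol (π k)) → IsNEI γ P r ρ ε π →
      (∀ (k : Fin n) (s : S), IsBRValI γ P (r k) (prodPolI π) k s (w k s)) →
      FeasNEI γ P r π w ∧ objNEI γ P r ρ π w ≤ (n : ℝ) * ε) := by
  refine ⟨fun π w hf hobj => ?_, fun π w hπ hNE hw => ?_⟩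
  · obtain ⟨hπ, hv⟩ := hf
    have hle : ∀ k : Fin n, ∀ π' : S → A k → ℝ, IsStatPol π' → ∀ s,
        vinf γ P (r k) (deviateI k π' (prodPolI π)) s ≤ w k s := fun k π' hπ' =>
      vinf_deviateI_le hγ hP (r k) hπ (hv k) hπ'
    have hgap : ∀ k, ∀ s, 0 ≤ ρ s * (w k s - vinf γ P (r k) (prodPolI π) s) := fun k s => by
      have h := hle k (π k) (hπ k) s
      rw [deviateI_self (hπ k)] at h
      exact mul_nonneg (hρ.1 s) (sub_nonneg.2 h)
    have hNE : IsNEI γ P r ρ ε π := fun k π' hπ' => by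
      calc _ = ∑ s, ρ s * (vinf γ P (r k) (deviateI k π' (prodPolI π)) s -
              vinf γ P (r k) (prodPolI π) s) := by
            simp only [vinfρ, mul_sub, Finset.sum_sub_distrib]
        _ ≤ ∑ s, ρ s * (w k s - vinf γ P (r k) (prodPolI π) s) :=
            Finset.sum_le_sum fun s _ =>
              mul_le_mul_of_nonneg_left (sub_le_sub_right (hle k π' hπ' s) _) (hρ.1 s)
        _ ≤ objNEI γ P r ρ π w :=
            Finset.single_le_sum
              (f := fun k => ∑ s, ρ s * (w k s - vinf γ P (r k) (prodPolI π) s))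
              (fun k _ => Finset.sum_nonneg fun s _ => hgap k s) (Finset.mem_univ k)
        _ ≤ ε := hobj
    refine ⟨hNE, fun k π' hπ' => (hNE k π' hπ').trans (le_mul_of_one_le_left hε ?_)⟩
    exact_mod_cast k.pos
  · have hS : Nonempty S := by
      by_contra h
      rw [not_nonempty_iff] at h
      simpa using hρ.2
    have hA : ∀ k, Nonempty (A k) := fun k => by
      by_contra h
      rw [not_nonempty_iff] at h
      simpa using (hπ k hS.some).2
    have hB := fun k => bellman_of_isBRValI hγ hP (r k) hπ (hw k)
    refine ⟨⟨hπ, fun k => (hB k).1⟩, ?_⟩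
    calc objNEI γ P r ρ π w ≤ ∑ _k : Fin n, ε := Finset.sum_le_sum fun k _ => by
          obtain ⟨π', hπ', h⟩ := (hB k).2
          have := hNE k π' hπ'
          simpa only [vinfρ, h, mul_sub, Finset.sum_sub_distrib] using this
      _ = n * ε := by simp
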